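/- arXiv:1209.0002 — 2 statements merged into one kernel-verified Lean document; each statement's English description precedes it below -/
import Mathlib

section
/- Let A, W ∈ SL(2,ℂ), set x := tr A, y := tr W, z := tr(A·W), β := tr(A·W·A·W⁻¹), and for integers m, n let U := (A·W·A·W⁻¹)^(1−m) · W and α := tr U. Then tr(U^(n−1)·A·W·A·W⁻¹·A⁻¹·A·W) − tr(A⁻¹·W⁻¹·A·W·A·U^(n−1)·A·W) = (x·y·z + 4 − x² − y² − z²) · [ (x·z − y)·S_{n−1}(α) − (S_m(β) − S_{m−1}(β))·S_{n−2}(α) ]. -/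
open Polynomial

/-- The trace of an element of `SL(2,ℂ)`, i.e. the trace of the underlying matrix. -/
noncomputable def tr (A : Matrix.SpecialLinearGroup (Fin 2) ℂ) : ℂ :=
  Matrix.trace (A : Matrix (Fin 2) (Fin 2) ℂ)

/-- The normalized Chebyshev polynomials `S k` (`k : ℤ`), determined by
`S 0 = 1`, `S 1 = X`, and the recurrence `S (k + 1) = X * S k - S (k - 1)` for all `k : ℤ`. -/
@[semireducible] noncomputable def chebS (R : Type*) [CommRing R] : ℤ → R[X]
  | 0 => 1
  | 1 => X
  | (n : ℕ) + 2 => X * chebS R (n + 1) - chebS R n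
  | -((n : ℕ) + 1) => X * chebS R (-n) - chebS R (-n + 1)
  termination_by n => Int.natAbs n + Int.natAbs (n - 1)

theorem chebS_add_two (R : Type*) [CommRing R] :
    ∀ k : ℤ, chebS R (k + 2) = X * chebS R (k + 1) - chebS R k
  | (k : ℕ) => chebS.eq_3 R k
  | -(k + 1 : ℕ) => by
    linear_combination (norm := (simp [Int.negSucc_eq]; ring_nf)) chebS.eq_4 R k

theorem chebS_zero (R : Type*) [CommRing R] : chebS R 0 = 1 := by simp [chebS]

theorem chebS_one (R : Type*) [CommRing R] : chebS R 1 = X := by simp [chebS]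

theorem chebS_neg_one (R : Type*) [CommRing R] : chebS R (-1) = 0 := by
  have h := chebS_add_two R (-1)
  norm_num [chebS_zero, chebS_one] at h
  linear_combination h

theorem chebS_eval_recurrence {R : Type*} [CommRing R] (t : R) (k : ℤ) :
    (chebS R (k + 1)).eval t + (chebS R (k - 1)).eval t = t * (chebS R k).eval t := by
  have h := congrArg (eval t) (chebS_add_two R (k - 1))
  rw [show k - 1 + 2 = k + 1 by ring, sub_add_cancel] at h
  simp only [eval_sub, eval_mul, eval_X] at h
  linear_combination h

/-- A sequence indexed by `ℤ` satisfying the Chebyshev recurrence with parameter `t`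
is determined by its values at `0` and `-1`. -/
theorem eq_chebS_of_recurrence {R : Type*} [CommRing R] (t : R) (f : ℤ → R)
    (hf : ∀ k, f (k + 1) + f (k - 1) = t * f k) (k : ℤ) :
    f k = (chebS R k).eval t * f 0 - (chebS R (k - 1)).eval t * f (-1) := by
  have hS := chebS_eval_recurrence t
  suffices h : ∀ j : ℤ, (f j = (chebS R j).eval t * f 0 - (chebS R (j - 1)).eval t * f (-1)) ∧
      f (j - 1) = (chebS R (j - 1)).eval t * f 0 - (chebS R (j - 1 - 1)).eval t * f (-1) from
    (h k).1
  intro j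
  induction j using Int.induction_on with
  | zero =>
    have h := hS (-1)
    norm_num [chebS_zero, chebS_neg_one] at h
    have h' : eval t (chebS R (-2)) = -1 := by linear_combination h
    norm_num [chebS_zero, chebS_neg_one, h']
  | succ i ih =>
    rw [add_sub_cancel_right]
    refine ⟨?_, ih.1⟩
    have h := hS (i - 1)
    rw [sub_add_cancel] at h
    linear_combination hf i - ih.2 + t * ih.1 - f 0 * hS i + f (-1) * h
  | pred i ih =>
    refine ⟨ih.2, ?_⟩
    have h := hf (-i - 1)
    have h₁ := hS (-i - 1)
    have h₂ := hS (-i - 1 - 1)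
    rw [sub_add_cancel] at h h₁ h₂
    linear_combination h - ih.1 + t * ih.2 - f 0 * h₁ + f (-1) * h₂

theorem tr_mul_comm (A B : Matrix.SpecialLinearGroup (Fin 2) ℂ) : tr (A * B) = tr (B * A) := by
  simpa only [tr, Matrix.SpecialLinearGroup.coe_mul] using Matrix.trace_mul_comm _ _

theorem tr_mul_mul_add_tr_mul_inv_mul (X P Y : Matrix.SpecialLinearGroup (Fin 2) ℂ) :
    tr (X * P * Y) + tr (X * P⁻¹ * Y) = tr P * tr (X * Y) := by
  simp [tr, Matrix.trace_fin_two, Matrix.mul_apply, Fin.sum_univ_two, Matrix.adjugate_fin_two]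
  ring

theorem tr_mul_zpow_mul (X P Y : Matrix.SpecialLinearGroup (Fin 2) ℂ) (k : ℤ) :
    tr (X * P ^ k * Y) = (chebS ℂ k).eval (tr P) * tr (X * Y)
      - (chebS ℂ (k - 1)).eval (tr P) * tr (X * P⁻¹ * Y) := by
  have h := eq_chebS_of_recurrence (tr P) (fun k => tr (X * P ^ k * Y)) (fun k => ?_) k
  · simpa using h
  · have h := tr_mul_mul_add_tr_mul_inv_mul (X * P ^ k) P Y
    simpa only [zpow_add_one, zpow_sub_one, mul_assoc] using h

section TraceIdentities

variable {R : Type*} [CommRing R] (A W : Matrix (Fin 2) (Fin 2) R)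

theorem Matrix.trace_commutator_fin_two :
    (adjugate A * adjugate W * A * W).trace
      = A.trace ^ 2 * W.det + W.trace ^ 2 * A.det + (A * W).trace ^ 2
        - A.trace * W.trace * (A * W).trace - 2 * A.det * W.det := by
  simp only [trace_fin_two, det_fin_two, Matrix.mul_apply, Fin.sum_univ_two, adjugate_fin_two,
    of_apply, cons_val_zero, cons_val_one, cons_val', cons_val_fin_one]
  ring

theorem Matrix.trace_mul_mul_sub_trace_commutator_mul_fin_two :
    A.det * W.det * (A * W * A).trace - (adjugate A * adjugate W * A * W * A * A * W).trace
      = (A.trace * W.trace * (A * W).trace + 4 * A.det * W.det - A.trace ^ 2 * W.det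
          - W.trace ^ 2 * A.det - (A * W).trace ^ 2)
        * (A.trace * (A * W).trace - A.det * W.trace) := by
  simp only [trace_fin_two, det_fin_two, Matrix.mul_apply, Fin.sum_univ_two, adjugate_fin_two,
    of_apply, cons_val_zero, cons_val_one, cons_val', cons_val_fin_one]
  ring

theorem Matrix.trace_mul_conj_sub_trace_commutator_mul_conj_fin_two :
    A.det * W.det * (A * W * A * adjugate W).trace
        - (adjugate A * adjugate W * A * W * A * adjugate W * A * W).trace
      = (A.trace * W.trace * (A * W).trace + 4 * A.det * W.det - A.trace ^ 2 * W.det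
          - W.trace ^ 2 * A.det - (A * W).trace ^ 2)
        * ((A * W * A * adjugate W).trace - A.det * W.det) := by
  simp only [trace_fin_two, det_fin_two, Matrix.mul_apply, Fin.sum_univ_two, adjugate_fin_two,
    of_apply, cons_val_zero, cons_val_one, cons_val', cons_val_fin_one]
  ring

end TraceIdentities

theorem two_sub_tr_commutator (A W : Matrix.SpecialLinearGroup (Fin 2) ℂ) :
    2 - tr (A⁻¹ * W⁻¹ * A * W)
      = tr A * tr W * tr (A * W) + 4 - tr A ^ 2 - tr W ^ 2 - tr (A * W) ^ 2 := by
  have h := Matrix.trace_commutator_fin_two (A : Matrix (Fin 2) (Fin 2) ℂ) W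
  simp only [Matrix.SpecialLinearGroup.det_coe] at h
  simp only [tr, Matrix.SpecialLinearGroup.coe_mul, Matrix.SpecialLinearGroup.coe_inv]
  linear_combination -h

theorem tr_mul_mul_sub_tr_commutator_mul (A W : Matrix.SpecialLinearGroup (Fin 2) ℂ) :
    tr (A * W * A) - tr (A⁻¹ * W⁻¹ * A * W * A * A * W)
      = (tr A * tr W * tr (A * W) + 4 - tr A ^ 2 - tr W ^ 2 - tr (A * W) ^ 2)
        * (tr A * tr (A * W) - tr W) := by
  have h := Matrix.trace_mul_mul_sub_trace_commutator_mul_fin_two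
    (A : Matrix (Fin 2) (Fin 2) ℂ) W
  simp only [Matrix.SpecialLinearGroup.det_coe] at h
  simp only [tr, Matrix.SpecialLinearGroup.coe_mul, Matrix.SpecialLinearGroup.coe_inv]
  linear_combination h

theorem tr_mul_conj_sub_tr_commutator_mul_conj (A W : Matrix.SpecialLinearGroup (Fin 2) ℂ) :
    tr (A * W * A * W⁻¹) - tr (A⁻¹ * W⁻¹ * A * W * A * W⁻¹ * A * W)
      = (tr A * tr W * tr (A * W) + 4 - tr A ^ 2 - tr W ^ 2 - tr (A * W) ^ 2)
        * (tr (A * W * A * W⁻¹) - 1) := by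
  have h := Matrix.trace_mul_conj_sub_trace_commutator_mul_conj_fin_two
    (A : Matrix (Fin 2) (Fin 2) ℂ) W
  simp only [Matrix.SpecialLinearGroup.det_coe] at h
  simp only [tr, Matrix.SpecialLinearGroup.coe_mul, Matrix.SpecialLinearGroup.coe_inv]
  linear_combination h

/-- With `x = tr A`, `y = tr W`, `z = tr (A*W)`, `β = tr (A*W*A*W⁻¹)`,
`U = (A*W*A*W⁻¹)^(1-m) * W` and `α = tr U`, one has
`tr (U^(n-1)*A*W*A*W⁻¹*A⁻¹*A*W) - tr (A⁻¹*W⁻¹*A*W*A*U^(n-1)*A*W)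
  = (x*y*z + 4 - x² - y² - z²) * ((x*z - y) * S (n-1) (α) - (S m (β) - S (m-1) (β)) * S (n-2) (α))`. -/
theorem trace_raw_sub_trace_revraw (A W : Matrix.SpecialLinearGroup (Fin 2) ℂ) (m n : ℤ) :
    tr (((A * W * A * W⁻¹) ^ (1 - m) * W) ^ (n - 1) * A * W * A * W⁻¹ * A⁻¹ * A * W)
      - tr (A⁻¹ * W⁻¹ * A * W * A * ((A * W * A * W⁻¹) ^ (1 - m) * W) ^ (n - 1) * A * W)
    = (tr A * tr W * tr (A * W) + 4 - tr A ^ 2 - tr W ^ 2 - tr (A * W) ^ 2)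
      * ((tr A * tr (A * W) - tr W)
            * (chebS ℂ (n - 1)).eval (tr ((A * W * A * W⁻¹) ^ (1 - m) * W))
        - ((chebS ℂ m).eval (tr (A * W * A * W⁻¹))
              - (chebS ℂ (m - 1)).eval (tr (A * W * A * W⁻¹)))
            * (chebS ℂ (n - 2)).eval (tr ((A * W * A * W⁻¹) ^ (1 - m) * W))) := by
  set c := tr A * tr W * tr (A * W) + 4 - tr A ^ 2 - tr W ^ 2 - tr (A * W) ^ 2 with hc
  set P := A * W * A * W⁻¹ with hP
  set U := P ^ (1 - m) * W with hU
  have hUinv : U⁻¹ = W⁻¹ * P ^ (m - 1) := by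
    rw [hU, mul_inv_rev, ← zpow_neg, neg_sub]
  have first_expand := tr_mul_zpow_mul 1 U (A * W * A) (n - 1)
  have second_expand := tr_mul_zpow_mul (A⁻¹ * W⁻¹ * A * W * A) U (A * W) (n - 1)
  have first_inv_expand := tr_mul_zpow_mul W⁻¹ P (A * W * A) (m - 1)
  have second_inv_expand := tr_mul_zpow_mul (A⁻¹ * W⁻¹ * A * W * A * W⁻¹) P (A * W) (m - 1)
  have first_cancel : W⁻¹ * P⁻¹ * (A * W * A) = 1 := by rw [hP]; group
  have second_cancel :
      A⁻¹ * W⁻¹ * A * W * A * W⁻¹ * P⁻¹ * (A * W) = A⁻¹ * W⁻¹ * A * W := by rw [hP]; group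
  have tr_one : tr 1 = 2 := by simp [tr]
  rw [first_cancel, tr_one, tr_mul_comm W⁻¹ (A * W * A), ← hP] at first_inv_expand
  rw [second_cancel] at second_inv_expand
  rw [hUinv] at first_expand second_expand
  simp only [one_mul, ← mul_assoc] at first_expand second_expand first_inv_expand second_inv_expand
  rw [first_inv_expand] at first_expand
  rw [second_inv_expand] at second_expand
  have h_one := tr_mul_mul_sub_tr_commutator_mul A W
  have h_conj := tr_mul_conj_sub_tr_commutator_mul_conj A W
  have h_comm := two_sub_tr_commutator A W
  have hS := chebS_eval_recurrence (tr P) (m - 1)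
  rw [← hc] at h_one h_conj h_comm
  rw [← hP] at h_conj
  rw [sub_add_cancel] at hS
  rw [show n - 1 - 1 = n - 2 by ring] at first_expand second_expand
  rw [inv_mul_cancel_right, inv_mul_cancel_right, first_expand, second_expand]
  linear_combination (chebS ℂ (n - 1)).eval (tr U) * h_one
    - (chebS ℂ (n - 2)).eval (tr U) * ((chebS ℂ (m - 1)).eval (tr P) * h_conj
      - (chebS ℂ (m - 1 - 1)).eval (tr P) * h_comm - c * hS)
end

section
/- Fix integers m, n with ¬(m = 0 ∧ n = −1). In the polynomial ring ℂ[x,y,z] (MvPolynomial (Fin 3) ℂ), set β := x·y·z + 2 − y² − z², α := y·S_{m−1}(β) − (x·z − y)·S_{m−2}(β), and Q := (x·z − y)·S_{n−1}(α) − (S_m(β) − S_{m−1}(β))·S_{n−2}(α). Then the polynomial (x·y·z + 4 − x² − y² − z²)·Q is squarefree, i.e., it has no non-unit repeated factors. -/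
open Polynomial

/-- `β = x*y*z + 2 - y² - z²` in `ℂ[x,y,z]`, where `x, y, z` are the three variables. -/
noncomputable def beta3 : MvPolynomial (Fin 3) ℂ :=
  MvPolynomial.X 0 * MvPolynomial.X 1 * MvPolynomial.X 2 + 2
    - MvPolynomial.X 1 ^ 2 - MvPolynomial.X 2 ^ 2

/-- `α = y * S (m-1) (β) - (x*z - y) * S (m-2) (β)` in `ℂ[x,y,z]`. -/
noncomputable def alpha3 (m : ℤ) : MvPolynomial (Fin 3) ℂ :=
  MvPolynomial.X 1 * (chebS (MvPolynomial (Fin 3) ℂ) (m - 1)).eval beta3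
    - (MvPolynomial.X 0 * MvPolynomial.X 2 - MvPolynomial.X 1)
        * (chebS (MvPolynomial (Fin 3) ℂ) (m - 2)).eval beta3

/-- `Q = (x*z - y) * S (n-1) (α) - (S m (β) - S (m-1) (β)) * S (n-2) (α)` in `ℂ[x,y,z]`. -/
noncomputable def Q3 (m n : ℤ) : MvPolynomial (Fin 3) ℂ :=
  (MvPolynomial.X 0 * MvPolynomial.X 2 - MvPolynomial.X 1)
      * (chebS (MvPolynomial (Fin 3) ℂ) (n - 1)).eval (alpha3 m)
    - ((chebS (MvPolynomial (Fin 3) ℂ) m).eval beta3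
          - (chebS (MvPolynomial (Fin 3) ℂ) (m - 1)).eval beta3)
        * (chebS (MvPolynomial (Fin 3) ℂ) (n - 2)).eval (alpha3 m)

open Polynomial.Chebyshev (S)

section Chebyshev

theorem chebS_eq_S (R : Type*) [CommRing R] (k : ℤ) : chebS R k = S R k := by
  induction k using Polynomial.Chebyshev.induct with
  | zero => rw [chebS, Polynomial.Chebyshev.S_zero]
  | one => rw [chebS, Polynomial.Chebyshev.S_one]
  | add_two n ih₁ ih₀ => rw [show chebS R (n + 2) = X * chebS R (n + 1) - chebS R n from chebS.eq_3 R n, ih₁, ih₀,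
      Polynomial.Chebyshev.S_add_two]
  | neg_add_one n ih₀ ih₁ =>
    rw [show chebS R (-n - 1) = X * chebS R (-n) - chebS R (-n + 1) by
        rw [show -(n : ℤ) - 1 = Int.negSucc n by omega]; exact chebS.eq_4 R n,
      ih₀, ih₁, ← Polynomial.Chebyshev.S_sub_one]

theorem eval_chebS {A : Type*} [CommRing A] [Algebra ℂ A] (q : A) (k : ℤ) :
    (chebS A k).eval q = aeval q (S ℂ k) := by
  rw [chebS_eq_S, ← Polynomial.Chebyshev.map_S (algebraMap ℂ A), eval_map_algebraMap]

/-- The first-order differential relation between `S n`, its derivative and `S (n - 1)`. -/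
theorem sq_sub_four_mul_derivative_S (R : Type*) [CommRing R] (n : ℤ) :
    (X ^ 2 - 4) * derivative (S R n) = (n : R[X]) * X * S R n - 2 * ((n : R[X]) + 1) * S R (n - 1) := by
  induction n using Polynomial.Chebyshev.induct with
  | zero => simp
  | one => simp; ring
  | add_two n ih₁ ih₀ =>
    have e : (n : ℤ) + 2 - 1 = n + 1 := by ring
    have e' : (n : ℤ) + 1 - 1 = n := by ring
    have h := Polynomial.Chebyshev.S_sub_one R n
    rw [e'] at ih₁
    rw [e, Polynomial.Chebyshev.S_add_two]
    simp only [derivative_sub, derivative_mul, derivative_X]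
    push_cast at *
    linear_combination X * ih₁ - ih₀ + 2 * ((n : R[X]) + 1) * h
  | neg_add_one n ih₀ ih₁ =>
    have e : -(n : ℤ) + 1 - 1 = -n := by ring
    have e' : -(n : ℤ) - 1 - 1 = -n - 2 := by ring
    have h := Polynomial.Chebyshev.S_sub_one R (-n)
    have h' := Polynomial.Chebyshev.S_sub_two R (-n)
    have hd := congrArg derivative h
    simp only [derivative_sub, derivative_mul, derivative_X] at hd
    rw [e] at ih₁
    rw [e', h']
    push_cast at *
    linear_combination X * ih₀ - ih₁ + (X ^ 2 - 4) * hd + ((n : R[X]) - 1) * X * h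

theorem S_sq_add_S_sub_one_sq (R : Type*) [CommRing R] (n : ℤ) :
    S R (n - 1) ^ 2 + S R n ^ 2 - X * S R (n - 1) * S R n = 1 := by
  have h := Polynomial.Chebyshev.S_sq_add_S_sq R (n - 1)
  rwa [sub_add_cancel] at h

theorem isCoprime_S_S_sub_one (R : Type*) [CommRing R] (n : ℤ) :
    IsCoprime (S R n) (S R (n - 1)) :=
  ⟨S R n - X * S R (n - 1), S R (n - 1), by
    linear_combination S_sq_add_S_sub_one_sq R n⟩

theorem isCoprime_S_derivative {K : Type*} [Field K] [CharZero K] {n : ℤ} (hn : n ≠ -1) :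
    IsCoprime (S K n) (derivative (S K n)) := by
  have hn' : (2 * ((n : K) + 1)) ≠ 0 :=
    mul_ne_zero two_ne_zero (by exact_mod_cast fun h => hn (eq_neg_of_add_eq_zero_left h))
  have hk : C ((2 * ((n : K) + 1))⁻¹) * (2 * ((n : K[X]) + 1)) = 1 := by
    have : (2 * ((n : K[X]) + 1)) = C (2 * ((n : K) + 1)) := by simp [C_ofNat]
    rw [this, ← C_mul, inv_mul_cancel₀ hn', C_1]
  have h := sq_sub_four_mul_derivative_S K n
  have hw := S_sq_add_S_sub_one_sq K n
  set k : K[X] := C ((2 * ((n : K) + 1))⁻¹)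
  set w := S K (n - 1) - X * S K n
  exact ⟨S K n + k * (n : K[X]) * X * w, -k * (X ^ 2 - 4) * w, by
    linear_combination hw - k * w * h + w * S K (n - 1) * hk⟩

theorem isCoprime_S_sub_S_derivative {K : Type*} [Field K] [CharZero K] (m : ℤ) :
    IsCoprime (S K m - S K (m - 1)) (derivative (S K m - S K (m - 1))) := by
  have hm : (2 * (m : K) + 1) ≠ 0 := by
    have : 2 * m + 1 ≠ 0 := by omega
    exact_mod_cast this
  have hk : C ((2 * (m : K) + 1)⁻¹) * (2 * (m : K[X]) + 1) = 1 := by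
    have : (2 * (m : K[X]) + 1) = C (2 * (m : K) + 1) := by simp [C_ofNat]
    rw [this, ← C_mul, inv_mul_cancel₀ hm, C_1]
  have h := sq_sub_four_mul_derivative_S K m
  have h' := sq_sub_four_mul_derivative_S K (m - 1)
  have e : m - 1 - 1 = m - 2 := by ring
  rw [e, Polynomial.Chebyshev.S_sub_two] at h'
  have hw := S_sq_add_S_sub_one_sq K m
  rw [derivative_sub]
  push_cast at h'
  set k : K[X] := C ((2 * (m : K) + 1)⁻¹)
  set s := S K (m - 1)
  set t := S K m
  exact ⟨(t + s - X * s) + k * (X - 2) * (m : K[X]) * s, -k * s * (X ^ 2 - 4), by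
    linear_combination hw - k * s * (h - h') - (X - 2) * s ^ 2 * hk⟩

theorem S_ne_zero {K : Type*} [Field K] [CharZero K] {n : ℤ} (hn : n ≠ -1) : S K n ≠ 0 := by
  intro h
  have h2 := Polynomial.Chebyshev.S_eval_two K n
  rw [h, eval_zero] at h2
  exact hn (eq_neg_of_add_eq_zero_left (by exact_mod_cast h2.symm))

end Chebyshev

section Divisibility

theorem degreeOf_eq_zero_iff_pderiv_eq_zero {σ K : Type*} [Field K] [CharZero K]
    {f : MvPolynomial σ K} {i : σ} :
    MvPolynomial.degreeOf i f = 0 ↔ MvPolynomial.pderiv i f = 0 := by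
  classical
  refine ⟨fun h => MvPolynomial.pderiv_eq_zero_of_notMem_vars ?_, fun h => ?_⟩
  · rwa [MvPolynomial.degreeOf_def, Multiset.count_eq_zero, ← Multiset.mem_toFinset,
      ← MvPolynomial.vars_def] at h
  · rw [← Nat.le_zero, MvPolynomial.degreeOf_le_iff]
    intro m hm
    by_contra hmi
    have hle : Finsupp.single i 1 ≤ m := Finsupp.single_le_iff.2 (by omega)
    have hc := MvPolynomial.coeff_pderiv (i := i) f (m - Finsupp.single i 1)
    rw [h, MvPolynomial.coeff_zero, tsub_add_cancel_of_le hle] at hc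
    exact mul_ne_zero (MvPolynomial.mem_support_iff.1 hm) (Nat.cast_add_one_ne_zero _) hc.symm

/-- If `f` divides a nonzero polynomial not involving the variable `i`, then `f` does not involve
`i` either, so the multiples of `f` are stable under differentiation with respect to `i`. -/
theorem dvd_pderiv_of_dvd {σ K : Type*} [Field K] [CharZero K] {f g h : MvPolynomial σ K} {i : σ}
    (hg : g ≠ 0) (hgi : MvPolynomial.pderiv i g = 0) (hfg : f ∣ g) (hfh : f ∣ h) :
    f ∣ MvPolynomial.pderiv i h := by
  obtain ⟨q, rfl⟩ := hfg
  obtain ⟨r, rfl⟩ := hfh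
  rw [← degreeOf_eq_zero_iff_pderiv_eq_zero,
    MvPolynomial.degreeOf_mul_eq (left_ne_zero_of_mul hg) (right_ne_zero_of_mul hg),
    Nat.add_eq_zero_iff, degreeOf_eq_zero_iff_pderiv_eq_zero] at hgi
  exact ⟨MvPolynomial.pderiv i r, by simp [hgi.1, Derivation.leibniz]⟩

theorem dvd_derivation_of_mul_self_dvd {R A : Type*} [CommRing R] [CommRing A] [Algebra R A]
    (D : Derivation R A A) {f g : A} (h : f * f ∣ g) : f ∣ D g := by
  obtain ⟨q, rfl⟩ := h
  exact ⟨f * D q + 2 * q * D f, by simp [Derivation.leibniz]; ring⟩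

/-- A prime dividing `P(q)` divides `q - r` for some root `r` of `P`. -/
theorem Prime.exists_root_dvd_sub {K A : Type*} [Field K] [IsAlgClosed K] [CommRing A]
    [Algebra K A] {f q : A} (hf : Prime f) {P : K[X]} (hP : P ≠ 0) (h : f ∣ aeval q P) :
    ∃ r, P.eval r = 0 ∧ f ∣ q - algebraMap K A r := by
  have hs := (IsAlgClosed.splits P).eq_prod_roots
  rw [hs, map_mul, aeval_C] at h
  rcases hf.dvd_or_dvd h with h | h
  · exact absurd (isUnit_of_dvd_unit h ((isUnit_iff_ne_zero.2
      (leadingCoeff_ne_zero.2 hP)).map (algebraMap K A))) hf.not_isUnit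
  · rw [map_multiset_prod, Multiset.map_map] at h
    obtain ⟨r, hr, hd⟩ := hf.exists_mem_multiset_map_dvd h
    exact ⟨r, (mem_roots hP).1 hr, by simpa using hd⟩

theorem dvd_aeval_sub_aeval {R A : Type*} [CommRing R] [CommRing A] [Algebra R A] {f a b : A}
    (h : f ∣ a - b) (P : R[X]) : f ∣ aeval a P - aeval b P := by
  simpa [eval_map_algebraMap] using h.trans ((P.map (algebraMap R A)).sub_dvd_eval_sub a b)

theorem dvd_aeval_sub_algebraMap {R A : Type*} [CommRing R] [CommRing A] [Algebra R A] {f a : A}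
    {r : R} (h : f ∣ a - algebraMap R A r) (P : R[X]) :
    f ∣ aeval a P - algebraMap R A (P.eval r) := by
  simpa [aeval_algebraMap_apply] using dvd_aeval_sub_aeval h P

theorem IsCoprime.not_dvd_aeval {R A : Type*} [CommRing R] [CommRing A] [Algebra R A] {P P' : R[X]}
    (h : IsCoprime P P') {f q : A} (hf : ¬ IsUnit f) (h₁ : f ∣ aeval q P) : ¬ f ∣ aeval q P' :=
  fun h₂ => hf ((h.map (aeval q).toRingHom).isUnit_of_dvd' h₁ h₂)

end Divisibility

section Surfaces

local notation "ℂxyz" => MvPolynomial (Fin 3) ℂ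
local notation "𝐱" => (MvPolynomial.X 0 : MvPolynomial (Fin 3) ℂ)
local notation "𝐲" => (MvPolynomial.X 1 : MvPolynomial (Fin 3) ℂ)
local notation "𝐳" => (MvPolynomial.X 2 : MvPolynomial (Fin 3) ℂ)
local notation "𝐩" => (𝐱 * 𝐳 - 𝐲)
local notation "κ" => (𝐱 * 𝐲 * 𝐳 + 4 - 𝐱 ^ 2 - 𝐲 ^ 2 - 𝐳 ^ 2)

theorem beta3_eq : beta3 = 𝐲 * 𝐩 + 2 - 𝐳 ^ 2 := by rw [beta3]; ring

theorem pderiv_ofNat {σ R : Type*} [CommRing R] (i : σ) (n : ℕ) [n.AtLeastTwo] :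
    MvPolynomial.pderiv i (ofNat(n) : MvPolynomial σ R) = 0 :=
  Derivation.map_natCast _ n

theorem ne_zero_of_eval_ne_zero {σ R : Type*} [CommRing R] {f : MvPolynomial σ R} (v : σ → R)
    (h : MvPolynomial.eval v f ≠ 0) : f ≠ 0 := fun h0 => h (by rw [h0, map_zero])

theorem C_dvd_iff {f : ℂxyz} {c : ℂ} (hc : c ≠ 0) (g : ℂxyz) :
    f ∣ MvPolynomial.C c * g ↔ f ∣ g :=
  ((isUnit_iff_ne_zero.2 hc).map MvPolynomial.C).dvd_mul_left

theorem isUnit_of_dvd_C {f : ℂxyz} {c : ℂ} (hc : c ≠ 0) (h : f ∣ MvPolynomial.C c) : IsUnit f :=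
  isUnit_of_dvd_unit h ((isUnit_iff_ne_zero.2 hc).map MvPolynomial.C)

theorem isUnit_of_dvd_beta3_sub_of_dvd_sub {f : ℂxyz} {r s : ℂ}
    (h₁ : f ∣ beta3 - MvPolynomial.C r) (h₂ : f ∣ 𝐩 - MvPolynomial.C s) : IsUnit f := by
  set g : ℂxyz := MvPolynomial.C s * 𝐱 * 𝐳 - 𝐳 ^ 2 + MvPolynomial.C (2 - r - s ^ 2) with hg
  have hfg : f ∣ g := by
    have : g = (beta3 - MvPolynomial.C r) - (𝐲 - MvPolynomial.C s) * (𝐩 - MvPolynomial.C s) := by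
      rw [hg, beta3_eq]
      simp only [map_sub, map_pow, map_ofNat]
      ring
    rw [this]
    exact dvd_sub h₁ (h₂.mul_left _)
  have hg0 : g ≠ 0 := by
    intro h0
    have e₀ := congrArg (MvPolynomial.eval ![0, 0, 0]) h0
    have e₁ := congrArg (MvPolynomial.eval ![0, 0, 1]) h0
    simp [hg] at e₀ e₁
    rw [e₀] at e₁
    norm_num at e₁
  have h := dvd_pderiv_of_dvd (i := 1) hg0 (by simp [hg, MvPolynomial.pderiv_X]) hfg h₂
  refine isUnit_of_dvd_C (c := -1) (by norm_num) ?_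
  simpa [MvPolynomial.pderiv_X] using h

theorem isUnit_of_dvd_beta3_sub_of_dvd_X_one {f : ℂxyz} {r : ℂ}
    (h₁ : f ∣ beta3 - MvPolynomial.C r) (h₂ : f ∣ 𝐲) : IsUnit f := by
  set g : ℂxyz := 𝐳 ^ 2 + MvPolynomial.C (r - 2) with hg
  have hfg : f ∣ g := by
    have : g = 𝐩 * 𝐲 - (beta3 - MvPolynomial.C r) := by
      rw [hg, beta3_eq]
      simp only [map_sub, map_ofNat]
      ring
    rw [this]
    exact dvd_sub (h₂.mul_left _) h₁
  have hg0 : g ≠ 0 := by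
    intro h0
    have e₀ := congrArg (MvPolynomial.eval ![0, 0, 0]) h0
    have e₁ := congrArg (MvPolynomial.eval ![0, 0, 1]) h0
    simp [hg] at e₀ e₁
    rw [e₀] at e₁
    norm_num at e₁
  have h := dvd_pderiv_of_dvd (i := 1) hg0 (by simp [hg, MvPolynomial.pderiv_X]) hfg h₂
  refine isUnit_of_dvd_C (c := 1) (by norm_num) ?_
  simpa [MvPolynomial.pderiv_X] using h

theorem isUnit_of_dvd_beta3_sub_of_dvd_X_two {f : ℂxyz} {r : ℂ}
    (h₁ : f ∣ beta3 - MvPolynomial.C r) (h₂ : f ∣ 𝐳) : IsUnit f := by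
  set g : ℂxyz := 𝐲 ^ 2 + MvPolynomial.C (r - 2) with hg
  have hfg : f ∣ g := by
    have : g = (𝐱 * 𝐲 - 𝐳) * 𝐳 - (beta3 - MvPolynomial.C r) := by
      rw [hg, beta3_eq]
      simp only [map_sub, map_ofNat]
      ring
    rw [this]
    exact dvd_sub (h₂.mul_left _) h₁
  have hg0 : g ≠ 0 := by
    intro h0
    have e₀ := congrArg (MvPolynomial.eval ![0, 0, 0]) h0
    have e₁ := congrArg (MvPolynomial.eval ![0, 1, 0]) h0
    simp [hg] at e₀ e₁
    rw [e₀] at e₁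
    norm_num at e₁
  have h := dvd_pderiv_of_dvd (i := 2) hg0 (by simp [hg, MvPolynomial.pderiv_X]) hfg h₂
  refine isUnit_of_dvd_C (c := 1) (by norm_num) ?_
  simpa [MvPolynomial.pderiv_X] using h

theorem not_dvd_linear_of_dvd_beta3_sub {f : ℂxyz} (hf : Prime f) {r a : ℂ} (k : ℂ) (ha : a ≠ 0)
    (h₁ : f ∣ beta3 - MvPolynomial.C r) :
    ¬ f ∣ MvPolynomial.C a * 𝐲 + MvPolynomial.C k * 𝐩 := by
  intro h₂
  set g : ℂxyz := MvPolynomial.C k * (MvPolynomial.C (2 - r) - 𝐳 ^ 2) - MvPolynomial.C a * 𝐲 ^ 2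
    with hg
  have hfg : f ∣ g := by
    have : g = MvPolynomial.C k * (beta3 - MvPolynomial.C r)
        - 𝐲 * (MvPolynomial.C a * 𝐲 + MvPolynomial.C k * 𝐩) := by
      rw [hg, beta3_eq]
      simp only [map_sub, map_ofNat]
      ring
    rw [this]
    exact dvd_sub (h₁.mul_left _) (h₂.mul_left _)
  have hg0 : g ≠ 0 := by
    intro h0
    have e₀ := congrArg (MvPolynomial.eval ![0, 0, 0]) h0
    have e₁ := congrArg (MvPolynomial.eval ![0, 1, 0]) h0
    simp only [hg, map_sub, map_mul, map_pow, MvPolynomial.eval_C, MvPolynomial.eval_X,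
      Matrix.cons_val, map_zero] at e₀ e₁
    exact ha (by linear_combination e₀ - e₁)
  have h := dvd_pderiv_of_dvd (i := 0) hg0 (by simp [hg, MvPolynomial.pderiv_X]) hfg h₁
  have h' : f ∣ 𝐲 * 𝐳 := by
    simpa [beta3, pderiv_ofNat, MvPolynomial.pderiv_X, mul_comm] using h
  rcases hf.dvd_or_dvd h' with h' | h'
  · exact hf.not_isUnit (isUnit_of_dvd_beta3_sub_of_dvd_X_one h₁ h')
  · exact hf.not_isUnit (isUnit_of_dvd_beta3_sub_of_dvd_X_two h₁ h')

theorem not_mul_self_dvd_kappa {f : ℂxyz} (hf : ¬ IsUnit f) : ¬ f * f ∣ κ := by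
  intro h
  have h₁ : f ∣ κ := (dvd_mul_right f f).trans h
  have h₂ : f ∣ 𝐲 * 𝐳 - 2 * 𝐱 := by
    simpa [pderiv_ofNat, MvPolynomial.pderiv_X, mul_comm] using
      dvd_derivation_of_mul_self_dvd (MvPolynomial.pderiv 0) h
  set g : ℂxyz := (𝐲 ^ 2 - 4) * (𝐳 ^ 2 - 4) with hg
  have hfg : f ∣ g := by
    have : g = 4 * κ + (𝐲 * 𝐳 - 2 * 𝐱) * (𝐲 * 𝐳 - 2 * 𝐱) := by rw [hg]; ring
    rw [this]
    exact dvd_add (h₁.mul_left _) (h₂.mul_left _)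
  have hg0 : g ≠ 0 := ne_zero_of_eval_ne_zero 0 (by simp [hg, map_ofNat])
  have h := dvd_pderiv_of_dvd (i := 0) hg0 (by simp [hg, pderiv_ofNat, MvPolynomial.pderiv_X]) hfg h₂
  refine hf (isUnit_of_dvd_C (c := 2) two_ne_zero ?_)
  simpa [pderiv_ofNat, MvPolynomial.pderiv_X, map_ofNat] using h

/-- Every nonunit factor of `κ` vanishes along the double line `y = 2`, `x = z`. -/
theorem eval_eq_zero_of_dvd_kappa {f : ℂxyz} (hf : ¬ IsUnit f) (h : f ∣ κ) (t : ℂ) :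
    MvPolynomial.eval ![t, 2, t] f = 0 := by
  set e := MvPolynomial.finSuccEquiv ℂ 2
  have hk : -e κ = X ^ 2 - C (MvPolynomial.X 0 * MvPolynomial.X 1) * X
      + C (MvPolynomial.X 0 ^ 2 + MvPolynomial.X 1 ^ 2 - 4) := by
    have h₁ : e 𝐲 = C (MvPolynomial.X 0) := MvPolynomial.finSuccEquiv_X_succ (j := 0)
    have h₂ : e 𝐳 = C (MvPolynomial.X 1) := MvPolynomial.finSuccEquiv_X_succ (j := 1)
    have h₀ : e 𝐱 = X := MvPolynomial.finSuccEquiv_X_zero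
    simp only [map_add, map_sub, map_mul, map_pow, map_ofNat, h₀, h₁, h₂]
    ring
  have hm : (-e κ).Monic := by rw [hk]; monicity!
  have hd : e f ∣ -e κ := dvd_neg.2 (map_dvd e h)
  have hu : IsUnit (e f).leadingCoeff := by
    obtain ⟨q, hq⟩ := hd
    rw [hq, Monic, leadingCoeff_mul] at hm
    exact IsUnit.of_mul_eq_one _ hm
  have hdeg : (e f).natDegree ≠ 0 := by
    intro h0
    refine hf ((MulEquiv.isUnit_map e).1 ?_)
    rw [eq_C_of_natDegree_eq_zero h0, ← h0]
    exact hu.map C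
  set φ : MvPolynomial (Fin 2) ℂ →+* ℂ := MvPolynomial.eval ![2, t]
  have hdeg' : ((e f).map φ).degree ≠ 0 := by
    intro h0
    apply hdeg
    rw [← natDegree_map_of_leadingCoeff_ne_zero φ (hu.map φ).ne_zero]
    exact natDegree_eq_of_degree_eq_some h0
  obtain ⟨a, ha⟩ := IsAlgClosed.exists_root _ hdeg'
  have hroot : (-e κ).map φ = (X - C t) ^ 2 := by
    rw [hk]
    simp [φ, C_ofNat]
    ring
  have hat : a = t := by
    have := ha.dvd (Polynomial.map_dvd φ hd)
    rw [hroot] at this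
    simpa [sub_eq_zero] using this
  rw [hat] at ha
  exact (MvPolynomial.eval_eq_eval_mv_eval' ![2, t] t f).trans ha

theorem alpha3_eq (m : ℤ) :
    alpha3 m = 𝐲 * aeval beta3 (S ℂ (m - 1)) - 𝐩 * aeval beta3 (S ℂ (m - 2)) := by
  simp only [alpha3, eval_chebS]

theorem Q3_eq (m n : ℤ) :
    Q3 m n = 𝐩 * aeval (alpha3 m) (S ℂ (n - 1))
      - aeval beta3 (S ℂ m - S ℂ (m - 1)) * aeval (alpha3 m) (S ℂ (n - 2)) := by
  simp only [Q3, eval_chebS, map_sub]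

/-- The partial derivative of `Q` with respect to `α`, with `p = x z - y` and `β` fixed. -/
noncomputable def Q3DerivAlpha (m n : ℤ) : ℂxyz :=
  𝐩 * aeval (alpha3 m) (derivative (S ℂ (n - 1)))
    - aeval beta3 (S ℂ m - S ℂ (m - 1)) * aeval (alpha3 m) (derivative (S ℂ (n - 2)))

/-- The partial derivative of `Q` with respect to `p = x z - y`, with `y` and `β` fixed. -/
noncomputable def Q3DerivP (m n : ℤ) : ℂxyz :=
  aeval (alpha3 m) (S ℂ (n - 1)) - aeval beta3 (S ℂ (m - 2)) * Q3DerivAlpha m n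

/-- The partial derivative of `Q` with respect to `y`, with `p = x z - y` and `β` fixed. -/
noncomputable def Q3DerivY (m n : ℤ) : ℂxyz :=
  aeval beta3 (S ℂ (m - 1)) * Q3DerivAlpha m n

/-- The partial derivative of `Q` with respect to `β`, with `p = x z - y` and `y` fixed. -/
noncomputable def Q3DerivBeta (m n : ℤ) : ℂxyz :=
  (𝐲 * aeval beta3 (derivative (S ℂ (m - 1))) - 𝐩 * aeval beta3 (derivative (S ℂ (m - 2))))
      * Q3DerivAlpha m n
    - aeval beta3 (derivative (S ℂ m - S ℂ (m - 1))) * aeval (alpha3 m) (S ℂ (n - 2))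

/-- The chain rule for `Q` as a polynomial in `y`, `p = x z - y` and `β`. -/
theorem derivation_Q3 (D : Derivation ℂ ℂxyz ℂxyz) (m n : ℤ) :
    D (Q3 m n) = Q3DerivP m n * D 𝐩 + Q3DerivY m n * D 𝐲 + Q3DerivBeta m n * D beta3 := by
  have ha : D (alpha3 m) = aeval beta3 (S ℂ (m - 1)) * D 𝐲 - aeval beta3 (S ℂ (m - 2)) * D 𝐩
      + (𝐲 * aeval beta3 (derivative (S ℂ (m - 1)))
        - 𝐩 * aeval beta3 (derivative (S ℂ (m - 2)))) * D beta3 := by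
    rw [alpha3_eq]
    generalize 𝐩 = p
    simp only [map_sub, Derivation.leibniz, Derivation.map_aeval, smul_eq_mul]
    ring
  rw [Q3_eq, Q3DerivP, Q3DerivY, Q3DerivBeta, Q3DerivAlpha]
  generalize 𝐩 = p at *
  rw [map_sub, Derivation.leibniz, Derivation.leibniz]
  simp only [Derivation.map_aeval, ha, smul_eq_mul]
  ring

theorem pderiv_zero_Q3 (m n : ℤ) :
    MvPolynomial.pderiv 0 (Q3 m n) = 𝐳 * (Q3DerivP m n + 𝐲 * Q3DerivBeta m n) := by
  rw [derivation_Q3, beta3]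
  simp [pderiv_ofNat, MvPolynomial.pderiv_X]
  ring

theorem pderiv_one_Q3 (m n : ℤ) :
    MvPolynomial.pderiv 1 (Q3 m n)
      = Q3DerivY m n - Q3DerivP m n + (𝐩 - 𝐲) * Q3DerivBeta m n := by
  rw [derivation_Q3, beta3]
  simp [pderiv_ofNat, MvPolynomial.pderiv_X]
  ring

theorem pderiv_two_Q3 (m n : ℤ) :
    MvPolynomial.pderiv 2 (Q3 m n)
      = 𝐱 * (Q3DerivP m n + 𝐲 * Q3DerivBeta m n) - 2 * (𝐳 * Q3DerivBeta m n) := by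
  rw [derivation_Q3, beta3]
  simp [pderiv_ofNat, MvPolynomial.pderiv_X]
  ring

theorem eval_aeval (v : Fin 3 → ℂ) (q : ℂxyz) (P : ℂ[X]) :
    MvPolynomial.eval v (aeval q P) = P.eval (MvPolynomial.eval v q) := by
  have := (Polynomial.aeval_algHom_apply (MvPolynomial.aeval v : ℂxyz →ₐ[ℂ] ℂ) q P).symm
  simpa [MvPolynomial.coe_aeval_eq_eval] using this

theorem not_X_two_mul_self_dvd_Q3 {m n : ℤ} (h : ¬(m = 0 ∧ n = -1)) : ¬ 𝐳 * 𝐳 ∣ Q3 m n := by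
  intro hd
  have hz : 𝐳 ∣ Q3DerivP m n + 𝐲 * Q3DerivBeta m n := by
    obtain ⟨g, hg⟩ := hd
    have hx := pderiv_zero_Q3 m n
    rw [hg] at hx
    refine ⟨MvPolynomial.pderiv 0 g, mul_left_cancel₀ (MvPolynomial.X_ne_zero (2 : Fin 3)) ?_⟩
    rw [← hx]
    simp [MvPolynomial.pderiv_X]
    ring
  have hy : 𝐳 ∣ Q3DerivY m n - Q3DerivP m n + (𝐩 - 𝐲) * Q3DerivBeta m n := by
    rw [← pderiv_one_Q3]
    exact dvd_derivation_of_mul_self_dvd _ hd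
  have ev : ∀ g : ℂxyz, 𝐳 ∣ g → MvPolynomial.eval 0 g = 0 := by
    rintro _ ⟨g, rfl⟩
    simp
  have e₀ := ev _ ((dvd_mul_right _ _).trans hd)
  have e₁ := ev _ hz
  have e₂ := ev _ hy
  have hb : MvPolynomial.eval 0 beta3 = 2 := by simp [beta3, map_ofNat]
  have ha : MvPolynomial.eval 0 (alpha3 m) = 0 := by simp [alpha3]
  have o₁ := congrArg (Polynomial.eval 0) (sq_sub_four_mul_derivative_S ℂ (n - 2))
  have o₂ := congrArg (Polynomial.eval 0) (Polynomial.Chebyshev.S_sub_two ℂ (n - 1))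
  have o₃ := congrArg (Polynomial.eval 0) (S_sq_add_S_sub_one_sq ℂ (n - 1))
  simp only [Q3_eq, Q3DerivY, Q3DerivP, Q3DerivAlpha, map_add, map_sub, map_mul, eval_aeval, ha, hb,
    MvPolynomial.eval_X, Polynomial.Chebyshev.S_eval_two, Pi.zero_apply] at e₀ e₁ e₂
  have s₁ : n - 1 - 1 = n - 2 := by ring
  have s₂ : n - 1 - 2 = n - 3 := by ring
  have s₃ : n - 2 - 1 = n - 3 := by ring
  simp only [s₁, s₂, s₃, eval_mul, eval_sub, eval_add, eval_pow, eval_X, eval_ofNat, eval_one,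
    eval_intCast] at o₁ o₂ o₃
  push_cast at e₀ e₁ e₂ o₁
  set u := (S ℂ (n - 1)).eval 0
  set v := (S ℂ (n - 2)).eval 0
  set w := (S ℂ (n - 3)).eval 0
  set d := (derivative (S ℂ (n - 2))).eval 0
  have hv : v = 0 := by linear_combination -e₀
  have hu : u ^ 2 = 1 := by linear_combination o₃ - v * hv
  have hdu : 2 * d = -(n - 1) * u := by linear_combination - o₁ / 2 + (n - 1) * o₂
  have hP : u + (m - 1) * d = 0 := by linear_combination e₁
  have hY : m * d = 0 := by linear_combination - e₂ - e₁
  have hmn : ((m - 1) * (n - 1) : ℂ) = 2 := by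
    linear_combination -2 * u * hP + (m - 1) * u * hdu - ((m - 1) * (n - 1) - 2) * hu
  have hmn' : (m * (n - 1) : ℂ) = 0 := by
    linear_combination u * m * hdu - 2 * u * hY - m * (n - 1) * hu
  norm_cast at hmn hmn'
  rcases mul_eq_zero.1 hmn' with hm | hn
  · subst hm
    exact h ⟨rfl, by linarith⟩
  · rw [hn] at hmn
    norm_num at hmn

theorem Q3_zero_left (n : ℤ) : Q3 0 n = aeval 𝐩 (S ℂ n) := by
  have ha : alpha3 0 = 𝐩 := by simp [alpha3_eq]
  rw [Q3_eq, ha, Polynomial.Chebyshev.S_eq ℂ n]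
  simp

theorem not_mul_self_dvd_Q3_zero_left {n : ℤ} (hn : n ≠ -1) {f : ℂxyz} (hf : Prime f) :
    ¬ f * f ∣ Q3 0 n := by
  intro hd
  rw [Q3_zero_left] at hd
  have h := dvd_derivation_of_mul_self_dvd (MvPolynomial.pderiv 1) hd
  have hy : MvPolynomial.pderiv 1 𝐩 = -1 := by simp [MvPolynomial.pderiv_X]
  rw [Derivation.map_aeval, hy, smul_eq_mul, mul_neg_one, dvd_neg] at h
  exact (isCoprime_S_derivative hn).not_dvd_aeval hf.not_isUnit ((dvd_mul_right f f).trans hd) h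

/-- The four polynomials `Q`, `∂Q/∂p`, `∂Q/∂α` and `∂Q/∂β` have no common prime factor. -/
theorem not_dvd_Q3DerivAlpha {m n : ℤ} {f : ℂxyz} (hf : Prime f) (hQ : f ∣ Q3 m n)
    (hP : f ∣ Q3DerivP m n) (hB : f ∣ Q3DerivBeta m n) : ¬ f ∣ Q3DerivAlpha m n := by
  intro hA
  have h₁ : f ∣ aeval (alpha3 m) (S ℂ (n - 1)) := by
    rw [Q3DerivP] at hP
    exact (dvd_sub_left (hA.mul_left _)).1 hP
  have h₂ : ¬ f ∣ aeval (alpha3 m) (S ℂ (n - 2)) := by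
    have := isCoprime_S_S_sub_one ℂ (n - 1)
    rw [show n - 1 - 1 = n - 2 by ring] at this
    exact this.not_dvd_aeval hf.not_isUnit h₁
  have hc : f ∣ aeval beta3 (S ℂ m - S ℂ (m - 1)) := by
    rw [Q3_eq] at hQ
    exact (hf.dvd_or_dvd ((dvd_sub_right (h₁.mul_left _)).1 hQ)).resolve_right h₂
  have hc' : f ∣ aeval beta3 (derivative (S ℂ m - S ℂ (m - 1))) := by
    rw [Q3DerivBeta] at hB
    exact (hf.dvd_or_dvd ((dvd_sub_right (hA.mul_left _)).1 hB)).resolve_right h₂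
  exact (isCoprime_S_sub_S_derivative m).not_dvd_aeval hf.not_isUnit hc hc'

/-- A prime factor of `S (m - 1) (β)` does not divide both `Q` and `∂Q/∂β`. -/
theorem not_dvd_Q3_of_dvd_aeval_S {m n : ℤ} (hm : m ≠ 0) {f : ℂxyz} (hf : Prime f)
    (hS : f ∣ aeval beta3 (S ℂ (m - 1))) (hB : f ∣ Q3DerivBeta m n) :
    ¬ f ∣ Q3 m n := by
  intro hQ
  obtain ⟨r, hr, hbr⟩ := hf.exists_root_dvd_sub (S_ne_zero (K := ℂ) (by omega)) hS
  have hb := dvd_aeval_sub_algebraMap hbr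
  set e := (S ℂ (m - 2)).eval r with he
  have he2 : e ^ 2 = 1 := by
    have := congrArg (Polynomial.eval r) (S_sq_add_S_sub_one_sq ℂ (m - 1))
    rw [show m - 1 - 1 = m - 2 by ring] at this
    simpa [hr] using this
  have he0 : e ≠ 0 := by intro h0; simp [h0] at he2
  have hE : (MvPolynomial.C e : ℂxyz) ^ 2 = 1 := by rw [← map_pow, he2, map_one]
  have hSm : (S ℂ m).eval r = -e := by
    rw [Polynomial.Chebyshev.S_eq]
    simp [hr, he]
  simp only [MvPolynomial.algebraMap_eq] at hbr hb
  have ha : f ∣ alpha3 m - MvPolynomial.C (-e) * 𝐩 := by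
    have : alpha3 m - MvPolynomial.C (-e) * 𝐩 = 𝐲 * aeval beta3 (S ℂ (m - 1))
        - 𝐩 * (aeval beta3 (S ℂ (m - 2)) - MvPolynomial.C e) := by
      rw [alpha3_eq, map_neg]; ring
    rw [this]
    exact dvd_sub (hS.mul_left _) ((hb _).mul_left _)
  have hc : f ∣ aeval beta3 (S ℂ m - S ℂ (m - 1)) + MvPolynomial.C e := by
    simpa [hr, hSm] using hb (S ℂ m - S ℂ (m - 1))
  by_cases hn : n = -1
  · subst hn
    have hd : (derivative (S ℂ (m - 1))).eval r ≠ 0 := by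
      intro h0
      obtain ⟨u, v, huv⟩ := isCoprime_S_derivative (K := ℂ) (n := m - 1) (by omega)
      have := congrArg (Polynomial.eval r) huv
      simp [hr, h0] at this
    have h3 : S ℂ (-1 - 2) = -X := by
      simpa using Polynomial.Chebyshev.S_neg_sub_two ℂ 1
    have hB' : Q3DerivBeta m (-1) = (𝐲 * aeval beta3 (derivative (S ℂ (m - 1)))
        - 𝐩 * aeval beta3 (derivative (S ℂ (m - 2)))) * aeval beta3 (S ℂ m - S ℂ (m - 1))
        + aeval beta3 (derivative (S ℂ m - S ℂ (m - 1))) * alpha3 m := by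
      have h2 : S ℂ (-1 - 1) = -1 := Polynomial.Chebyshev.S_neg_two ℂ
      rw [Q3DerivBeta, Q3DerivAlpha, h2, h3]
      simp
    set k := -(derivative (S ℂ (m - 2))).eval r + (derivative (S ℂ m - S ℂ (m - 1))).eval r with hk
    refine not_dvd_linear_of_dvd_beta3_sub hf k hd hbr ((C_dvd_iff (neg_ne_zero.2 he0) _).1 ?_)
    obtain ⟨g₁, hg₁⟩ := hb (derivative (S ℂ (m - 1)))
    obtain ⟨g₂, hg₂⟩ := hb (derivative (S ℂ (m - 2)))
    obtain ⟨g₃, hg₃⟩ := hb (derivative (S ℂ m - S ℂ (m - 1)))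
    obtain ⟨g₄, hg₄⟩ := hc
    obtain ⟨g₅, hg₅⟩ := ha
    obtain ⟨g₆, hg₆⟩ := hB
    rw [hB'] at hg₆
    set B := 𝐲 * aeval beta3 (derivative (S ℂ (m - 1)))
      - 𝐩 * aeval beta3 (derivative (S ℂ (m - 2)))
    set B' := aeval beta3 (derivative (S ℂ m - S ℂ (m - 1)))
    rw [map_neg] at hg₅
    rw [hk, map_neg, map_add, map_neg]
    refine ⟨g₆ - B * g₄ + MvPolynomial.C e * (𝐲 * g₁ - 𝐩 * g₂) - B' * g₅
      + MvPolynomial.C e * 𝐩 * g₃, ?_⟩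
    linear_combination hg₆ - B * hg₄ + MvPolynomial.C e * (𝐲 * hg₁ - 𝐩 * hg₂) - B' * hg₅
      + MvPolynomial.C e * 𝐩 * hg₃
  · have hS' := dvd_aeval_sub_aeval (R := ℂ) ha
    set q := MvPolynomial.C (-e) * 𝐩 with hq
    have hqS : f ∣ aeval q (S ℂ n) := by
      rw [← C_dvd_iff (neg_ne_zero.2 he0), Polynomial.Chebyshev.S_eq]
      obtain ⟨g₁, hg₁⟩ := hS' (S ℂ (n - 1))
      obtain ⟨g₂, hg₂⟩ := hS' (S ℂ (n - 2))
      obtain ⟨g₃, hg₃⟩ := hc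
      obtain ⟨g₄, hg₄⟩ := hQ
      rw [Q3_eq] at hg₄
      simp only [map_mul, map_neg, map_sub _ (X * _), aeval_X] at hq ⊢
      refine ⟨g₄ - 𝐩 * g₁ + g₃ * aeval (alpha3 m) (S ℂ (n - 2)) - MvPolynomial.C e * g₂, ?_⟩
      linear_combination hg₄ - 𝐩 * hg₁ + aeval (alpha3 m) (S ℂ (n - 2)) * hg₃
        - MvPolynomial.C e * hg₂ + 𝐩 * aeval q (S ℂ (n - 1)) * hE
        - MvPolynomial.C e * aeval q (S ℂ (n - 1)) * hq
    obtain ⟨s, -, hs⟩ := hf.exists_root_dvd_sub (S_ne_zero (K := ℂ) hn) hqS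
    refine hf.not_isUnit (isUnit_of_dvd_beta3_sub_of_dvd_sub (s := -e * s) hbr
      ((C_dvd_iff (neg_ne_zero.2 he0) _).1 ?_))
    convert hs using 1
    rw [MvPolynomial.algebraMap_eq, hq]
    simp only [map_mul, map_neg]
    linear_combination -MvPolynomial.C s * hE

theorem not_mul_self_dvd_Q3 {m n : ℤ} (h : ¬(m = 0 ∧ n = -1)) {f : ℂxyz} (hf : Prime f) :
    ¬ f * f ∣ Q3 m n := by
  intro hd
  by_cases hm : m = 0
  · subst hm
    exact not_mul_self_dvd_Q3_zero_left (fun hn => h ⟨rfl, hn⟩) hf hd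
  by_cases hz : f ∣ 𝐳
  · have hfz := hf.irreducible.associated_of_dvd
      (MvPolynomial.X_prime (i := (2 : Fin 3))).irreducible hz
    exact not_X_two_mul_self_dvd_Q3 h ((hfz.mul_mul hfz).symm.dvd.trans hd)
  have hQ : f ∣ Q3 m n := (dvd_mul_right f f).trans hd
  have h₀ := dvd_derivation_of_mul_self_dvd (MvPolynomial.pderiv 0) hd
  have h₁ := dvd_derivation_of_mul_self_dvd (MvPolynomial.pderiv 1) hd
  have h₂ := dvd_derivation_of_mul_self_dvd (MvPolynomial.pderiv 2) hd
  rw [pderiv_zero_Q3] at h₀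
  rw [pderiv_one_Q3] at h₁
  rw [pderiv_two_Q3] at h₂
  have hPB := (hf.dvd_or_dvd h₀).resolve_left hz
  have hB : f ∣ Q3DerivBeta m n := by
    have h' := (dvd_sub_right (hPB.mul_left _)).1 h₂
    rw [← map_ofNat MvPolynomial.C, C_dvd_iff two_ne_zero] at h'
    exact (hf.dvd_or_dvd h').resolve_left hz
  have hP : f ∣ Q3DerivP m n := (dvd_add_left (hB.mul_left _)).1 hPB
  have hY : f ∣ Q3DerivY m n := (dvd_sub_left hP).1 ((dvd_add_left (hB.mul_left _)).1 h₁)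
  rcases hf.dvd_or_dvd hY with hS | hA
  · exact not_dvd_Q3_of_dvd_aeval_S hm hf hS hB hQ
  · exact not_dvd_Q3DerivAlpha hf hQ hP hB hA

theorem eval_Q3_two_two_two (m n : ℤ) : MvPolynomial.eval ![2, 2, 2] (Q3 m n) = n + 1 := by
  have hb : MvPolynomial.eval ![2, 2, 2] beta3 = 2 := by
    simp [beta3, map_ofNat]; norm_num
  have ha : MvPolynomial.eval ![2, 2, 2] (alpha3 m) = 2 := by
    simp only [alpha3_eq, map_sub, map_mul, eval_aeval, hb, MvPolynomial.eval_X, Matrix.cons_val,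
      Polynomial.Chebyshev.S_eval_two]
    push_cast
    ring
  simp only [Q3_eq, map_sub, map_mul, eval_aeval, hb, ha, MvPolynomial.eval_X, Matrix.cons_val,
    Polynomial.Chebyshev.S_eval_two]
  push_cast
  ring

theorem eval_Q3_neg_one (m : ℤ) : MvPolynomial.eval ![0, 2, 0] (Q3 m (-1)) = -4 * m := by
  have hb : MvPolynomial.eval ![0, 2, 0] beta3 = -2 := by
    simp [beta3, map_ofNat]; norm_num
  have h3 : S ℂ (-1 - 2) = -X := by
    simpa using Polynomial.Chebyshev.S_neg_sub_two ℂ 1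
  have h2 : S ℂ (-1 - 1) = -1 := Polynomial.Chebyshev.S_neg_two ℂ
  have hε : ((m.negOnePow : ℤ) : ℂ) ^ 2 = 1 := by
    rw [← Int.cast_pow, ← Units.val_pow_eq_pow_val, Int.units_sq, Units.val_one, Int.cast_one]
  simp only [Q3_eq, h2, h3, map_neg, map_one, aeval_X, alpha3_eq, map_sub, map_mul, eval_aeval, hb,
    MvPolynomial.eval_X, Matrix.cons_val, Polynomial.Chebyshev.S_eval_neg_two, Int.negOnePow_sub,
    Int.negOnePow_one, Int.negOnePow_even 2 even_two]
  push_cast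
  linear_combination (-4 * (m : ℂ) - 2) * hε

theorem exists_eval_Q3_ne_zero {m n : ℤ} (h : ¬(m = 0 ∧ n = -1)) :
    ∃ t : ℂ, MvPolynomial.eval ![t, 2, t] (Q3 m n) ≠ 0 := by
  by_cases hn : n = -1
  · subst hn
    refine ⟨0, ?_⟩
    rw [eval_Q3_neg_one]
    exact mul_ne_zero (by norm_num) (Int.cast_ne_zero.2 fun hm => h ⟨hm, rfl⟩)
  · refine ⟨2, ?_⟩
    rw [eval_Q3_two_two_two]
    exact_mod_cast fun h0 => hn (eq_neg_of_add_eq_zero_left h0)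

end Surfaces

/-- If `¬(m = 0 ∧ n = -1)` then `(x*y*z + 4 - x² - y² - z²) * Q` is squarefree. -/
theorem squarefree_defining_polynomial (m n : ℤ) (h : ¬(m = 0 ∧ n = -1)) :
    Squarefree
      ((MvPolynomial.X 0 * MvPolynomial.X 1 * MvPolynomial.X 2 + 4
          - MvPolynomial.X 0 ^ 2 - MvPolynomial.X 1 ^ 2 - MvPolynomial.X 2 ^ 2) * Q3 m n) := by
  obtain ⟨t, ht⟩ := exists_eval_Q3_ne_zero h
  rw [squarefree_iff_irreducible_sq_not_dvd_of_exists_irreducible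
    ⟨_, (MvPolynomial.X_prime (i := (0 : Fin 3))).irreducible⟩]
  intro f hirr hd
  have hf := hirr.prime
  set k : MvPolynomial (Fin 3) ℂ := MvPolynomial.X 0 * MvPolynomial.X 1 * MvPolynomial.X 2 + 4
    - MvPolynomial.X 0 ^ 2 - MvPolynomial.X 1 ^ 2 - MvPolynomial.X 2 ^ 2
  by_cases hk : f ∣ k
  · have hQ : ¬ f ∣ Q3 m n := by
      rintro ⟨q, hq⟩
      rw [hq, map_mul, eval_eq_zero_of_dvd_kappa hf.not_isUnit hk, zero_mul] at ht
      exact ht rfl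
    rw [← sq] at hd
    refine not_mul_self_dvd_kappa hf.not_isUnit ?_
    rw [← sq]
    exact hf.pow_dvd_of_dvd_mul_right 2 hQ hd
  · refine not_mul_self_dvd_Q3 h hf ?_
    rw [← sq] at hd ⊢
    exact hf.pow_dvd_of_dvd_mul_left 2 hk hd
end
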